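/- For a partition ν ⊢ n with conjugate (transposed) partition ν′, the normalized character of the irreducible representation ρ_ν of S_n at any transposition τ satisfies χ_ν(τ)/dim(ρ_ν) = (1/C(n,2)) ∑_j (C(ν_j, 2) − C(ν′_j, 2)). -/

import Mathlib

/-- A family of representations of `Sₙ` indexed by partitions of `n` is a complete set of
pairwise inequivalent irreducible representations. -/
def IsCompleteIrrepFamily (n : ℕ)
    (ρ : Nat.Partition n → FDRep ℂ (Equiv.Perm (Fin n))) : Prop :=
  (∀ ν, CategoryTheory.Simple (ρ ν)) ∧
    (∀ ν η, Nonempty (ρ ν ≅ ρ η) → ν = η) ∧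
    (∀ W : FDRep ℂ (Equiv.Perm (Fin n)), CategoryTheory.Simple W →
      ∃ ν, Nonempty (W ≅ ρ ν))

/-- The `j`-th part of the conjugate (transposed) partition of `ν`: the number of parts of
`ν` that are at least `j`. -/
def conjugatePart {n : ℕ} (ν : Nat.Partition n) (j : ℕ) : ℕ :=
  (ν.parts.filter fun a => j ≤ a).card

/-- `r` and `c` are the row and column indices of a labelling by `α` of the cells of a diagram whose
columns are top-justified. -/
structure IsFilling {α : Type*} (r c : α → ℕ) : Prop where
  eq_of_row_col : ∀ x y, r x = r y → c x = c y → x = y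
  exists_above : ∀ x, ∀ i < r x, ∃ y, r y = i ∧ c y = c x

theorem card_comp_perm_lt {α : Type*} [Fintype α] (r : α → ℕ) (g : Equiv.Perm α) (k : ℕ) :
    (Finset.univ.filter fun x => (r ∘ g) x < k).card =
      (Finset.univ.filter fun x => r x < k).card :=
  Finset.card_equiv g (by simp)

namespace IsFilling

variable {α : Type*} [Fintype α] {r c f : α → ℕ}

theorem card_column_lt_le (h : IsFilling r c)
    (hf : ∀ x y, c x = c y → f x = f y → x = y) (j k : ℕ) :
    (Finset.univ.filter fun x => c x = j ∧ f x < k).card ≤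
      (Finset.univ.filter fun x => c x = j ∧ r x < k).card := by
  by_cases hk : ∃ x, c x = j ∧ k ≤ r x
  · obtain ⟨x, hxj, hxk⟩ := hk
    calc
      (Finset.univ.filter fun x => c x = j ∧ f x < k).card ≤ (Finset.range k).card := by
        refine Finset.card_le_card_of_injOn f (fun y hy => ?_) (fun y hy z hz hyz => ?_)
        · simp only [Finset.coe_filter, Set.mem_ofPred_eq] at hy
          simpa using hy.2.2
        · simp only [Finset.coe_filter, Set.mem_ofPred_eq] at hy hz
          exact hf y z (hy.2.1.trans hz.2.1.symm) hyz
      _ ≤ ((Finset.univ.filter fun x => c x = j ∧ r x < k).image r).card := by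
        refine Finset.card_le_card fun i hi => ?_
        have hik : i < k := Finset.mem_range.1 hi
        obtain ⟨y, hy, hyc⟩ := h.exists_above x i (by omega)
        exact Finset.mem_image.2 ⟨y, by simp [hy, hyc, hxj, hik], hy⟩
      _ ≤ _ := Finset.card_image_le
  · push Not at hk
    refine Finset.card_le_card fun x hx => ?_
    simp only [Finset.mem_filter, Finset.mem_univ, true_and] at hx ⊢
    exact ⟨hx.1, hk x hx.1⟩

theorem sum_card_column_lt (f c : α → ℕ) (k : ℕ) :
    ∑ j ∈ Finset.univ.image c, (Finset.univ.filter fun x => c x = j ∧ f x < k).card =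
      (Finset.univ.filter fun x => f x < k).card := by
  rw [Finset.card_eq_sum_card_fiberwise (f := c) (t := Finset.univ.image c)
    (fun x _ => by simp)]
  simp only [Finset.filter_filter, and_comm]

theorem card_lt_le (h : IsFilling r c)
    (hf : ∀ x y, c x = c y → f x = f y → x = y) (k : ℕ) :
    (Finset.univ.filter fun x => f x < k).card ≤ (Finset.univ.filter fun x => r x < k).card := by
  rw [← sum_card_column_lt f c, ← sum_card_column_lt r c]
  exact Finset.sum_le_sum fun j _ => h.card_column_lt_le hf j k

theorem card_column_lt_eq (h : IsFilling r c)
    (hf : ∀ x y, c x = c y → f x = f y → x = y)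
    (hfr : ∀ k, (Finset.univ.filter fun x => f x < k).card =
      (Finset.univ.filter fun x => r x < k).card) (x : α) (k : ℕ) :
    (Finset.univ.filter fun y => c y = c x ∧ f y < k).card =
      (Finset.univ.filter fun y => c y = c x ∧ r y < k).card := by
  have hk := hfr k
  rw [← sum_card_column_lt f c, ← sum_card_column_lt r c,
    Finset.sum_eq_sum_iff_of_le fun j _ => h.card_column_lt_le hf j k] at hk
  exact hk (c x) (Finset.mem_image_of_mem c (Finset.mem_univ x))

theorem exists_perm (h : IsFilling r c)
    (hf : ∀ x y, c x = c y → f x = f y → x = y)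
    (hfr : ∀ k, (Finset.univ.filter fun x => f x < k).card =
      (Finset.univ.filter fun x => r x < k).card) :
    ∃ σ : Equiv.Perm α, f = r ∘ σ ∧ c ∘ σ = c := by
  have key : ∀ x, ∃ y, r y = f x ∧ c y = c x := by
    intro x
    by_contra! hx
    have h1 := h.card_column_lt_eq hf hfr x (f x)
    have h2 := h.card_column_lt_eq hf hfr x (f x + 1)
    have h3 : (Finset.univ.filter fun y => c y = c x ∧ r y < f x + 1) =
        Finset.univ.filter fun y => c y = c x ∧ r y < f x := by
      ext y
      have := hx y
      simp only [Finset.mem_filter, Finset.mem_univ, true_and]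
      grind
    have h4 : (Finset.univ.filter fun y => c y = c x ∧ f y < f x).card <
        (Finset.univ.filter fun y => c y = c x ∧ f y < f x + 1).card := by
      refine Finset.card_lt_card (Finset.ssubset_iff_of_subset (fun y => ?_) |>.2 ⟨x, ?_, ?_⟩)
      · simp only [Finset.mem_filter, Finset.mem_univ, true_and]
        grind
      · simp
      · simp
    rw [h3] at h2
    omega
  choose s hs using key
  have hinj : Function.Injective s := fun x y hxy =>
    hf x y (by rw [← (hs x).2, ← (hs y).2, hxy]) (by rw [← (hs x).1, ← (hs y).1, hxy])
  exact ⟨Equiv.ofBijective s (Finite.injective_iff_bijective.1 hinj),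
    funext fun x => (hs x).1.symm, funext fun x => (hs x).2⟩

end IsFilling

section

variable {α : Type*} [Fintype α] [DecidableEq α]

/-- The coefficient at the row colouring `f` of the polytabloid of the filling with row indices `r`
and column indices `c`. -/
def columnDet (r c f : α → ℕ) : ℂ :=
  (Matrix.of fun x y => if f x = r y ∧ c x = c y then (1 : ℂ) else 0).det

theorem columnDet_comp (r c f : α → ℕ) {σ : Equiv.Perm α} (hσ : c ∘ σ = c) :
    columnDet r c (f ∘ σ) = (Equiv.Perm.sign σ : ℤ) * columnDet r c f := by
  rw [columnDet, columnDet, ← Matrix.det_permute]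
  congr 1
  ext x y
  have := congrFun hσ x
  simp only [Function.comp_apply] at this
  simp [this]

theorem columnDet_self {r c : α → ℕ} (h : IsFilling r c) : columnDet r c r = 1 := by
  refine (congrArg Matrix.det ?_).trans Matrix.det_one
  ext x y
  rw [Matrix.one_apply, Matrix.of_apply]
  refine if_congr ⟨fun hxy => h.eq_of_row_col x y hxy.1 hxy.2, ?_⟩ rfl rfl
  rintro rfl
  simp

theorem exists_perm_of_columnDet_ne_zero {r c f : α → ℕ} (hf : columnDet r c f ≠ 0) :
    ∃ g : Equiv.Perm α, f = r ∘ g := by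
  rw [columnDet, Matrix.det_apply] at hf
  obtain ⟨σ, -, hσ⟩ := Finset.exists_ne_zero_of_sum_ne_zero hf
  refine ⟨σ⁻¹, funext fun x => ?_⟩
  have h1 : ∏ i, (Matrix.of fun x y => if f x = r y ∧ c x = c y then (1 : ℂ) else 0) (σ i) i ≠ 0 :=
    fun h0 => hσ (by rw [h0, smul_zero])
  have h2 := Finset.prod_ne_zero_iff.1 h1 (σ⁻¹ x) (Finset.mem_univ _)
  by_contra hne
  exact h2 (if_neg fun h3 => hne (by simpa using h3.1))

theorem columnDet_comp_swap {r c : α → ℕ} (h : IsFilling r c) {i j : α} (hij : i ≠ j) :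
    columnDet r c (r ∘ Equiv.swap i j) =
      (if r i = r j then 1 else 0) - (if c i = c j then 1 else 0) := by
  by_cases hr : r i = r j
  · have hc : c i ≠ c j := fun hc => hij (h.eq_of_row_col i j hr hc)
    have : r ∘ Equiv.swap i j = r := by
      ext x
      simp only [Function.comp_apply, Equiv.swap_apply_def]
      grind
    rw [this, columnDet_self h]
    simp [hr, hc]
  by_cases hc : c i = c j
  · have : c ∘ Equiv.swap i j = c := by
      ext x
      simp only [Function.comp_apply, Equiv.swap_apply_def]
      grind
    rw [columnDet_comp r c r this, columnDet_self h]
    simp [hr, hc, Equiv.Perm.sign_swap hij]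
  simp only [hr, hc, if_false, sub_zero]
  by_cases hy : ∃ y, r y = r j ∧ c y = c i
  · obtain ⟨y, hyr, hyc⟩ := hy
    have hyi : y ≠ i := by grind
    have hyj : y ≠ j := by grind
    refine Matrix.det_zero_of_row_eq hyi.symm ?_
    ext z
    simp [Equiv.swap_apply_of_ne_of_ne hyi hyj, hyr, hyc]
  · refine Matrix.det_eq_zero_of_row_eq_zero i fun y => ?_
    simp only [Matrix.of_apply, Function.comp_apply, Equiv.swap_apply_left, ite_eq_right_iff]
    exact fun hy' => absurd ⟨y, hy'.1.symm, hy'.2.symm⟩ hy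

theorem eq_of_apply_ne_zero {c : α → ℕ} {w : (α → ℕ) → ℂ}
    (hw : ∀ f (σ : Equiv.Perm α), c ∘ σ = c → w (f ∘ σ) = (Equiv.Perm.sign σ : ℤ) * w f)
    {f : α → ℕ} (hf : w f ≠ 0) (x y : α) (hc : c x = c y) (hxy : f x = f y) : x = y := by
  by_contra hne
  have h1 : c ∘ Equiv.swap x y = c := by
    ext z
    simp only [Function.comp_apply, Equiv.swap_apply_def]
    grind
  have h2 : f ∘ Equiv.swap x y = f := by
    ext z
    simp only [Function.comp_apply, Equiv.swap_apply_def]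
    grind
  have h3 := hw f _ h1
  rw [h2, Equiv.Perm.sign_swap hne] at h3
  apply hf
  push_cast at h3
  linear_combination h3 / 2

theorem eq_smul_columnDet {r c : α → ℕ} (h : IsFilling r c) {w : (α → ℕ) → ℂ}
    (hw : ∀ f (σ : Equiv.Perm α), c ∘ σ = c → w (f ∘ σ) = (Equiv.Perm.sign σ : ℤ) * w f)
    (hsupp : ∀ f, w f ≠ 0 → ∃ g : Equiv.Perm α, f = r ∘ g) :
    w = w r • columnDet r c := by
  ext f
  rw [Pi.smul_apply, smul_eq_mul]
  have main : ∀ v : (α → ℕ) → ℂ,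
      (∀ f (σ : Equiv.Perm α), c ∘ σ = c → v (f ∘ σ) = (Equiv.Perm.sign σ : ℤ) * v f) →
      (∀ f, v f ≠ 0 → ∃ g : Equiv.Perm α, f = r ∘ g) → v f ≠ 0 →
      ∃ σ : Equiv.Perm α, f = r ∘ σ ∧ c ∘ σ = c := by
    intro v hv hvs hvf
    refine h.exists_perm (eq_of_apply_ne_zero hv hvf) fun k => ?_
    obtain ⟨g, rfl⟩ := hvs f hvf
    exact card_comp_perm_lt r g k
  by_cases hf : ∃ σ : Equiv.Perm α, f = r ∘ σ ∧ c ∘ σ = c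
  · obtain ⟨σ, rfl, hσ⟩ := hf
    rw [hw r σ hσ, columnDet_comp r c r hσ, columnDet_self h]
    ring
  · have h1 : w f = 0 := by_contra fun h0 => hf (main w hw hsupp h0)
    have h2 : columnDet r c f = 0 := by_contra fun h0 => hf
      (main _ (fun f σ hσ => columnDet_comp r c f hσ)
        (fun f hf => exists_perm_of_columnDet_ne_zero hf) h0)
    rw [h1, h2, mul_zero]

end

section

variable {α : Type} [Fintype α] [DecidableEq α]

/-- The permutation representation of `Perm α` on functions of colourings of `α` by `ℕ`. -/
def colourRep (α : Type*) : Representation ℂ (Equiv.Perm α) ((α → ℕ) → ℂ) where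
  toFun g := LinearMap.funLeft ℂ ℂ fun f => f ∘ g
  map_one' := rfl
  map_mul' _ _ := rfl

/-- The Specht module, generated by the polytabloid of the filling with row indices `r` and column
indices `c`. -/
def specht (r c : α → ℕ) : Subrepresentation (colourRep α) where
  toSubmodule := Submodule.span ℂ (Set.range fun g => colourRep α g (columnDet r c))
  apply_mem_toSubmodule g v hv := by
    induction hv using Submodule.span_induction with
    | mem x hx =>
      obtain ⟨g', rfl⟩ := hx
      refine Submodule.subset_span ⟨g * g', ?_⟩
      simp only [map_mul]
      rfl
    | zero => simp
    | add x y _ _ hx hy => rw [map_add]; exact add_mem hx hy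
    | smul a x _ hx => rw [map_smul]; exact Submodule.smul_mem _ a hx

instance (r c : α → ℕ) : Module.Finite ℂ (specht r c).toSubmodule :=
  Module.Finite.span_of_finite ℂ (Set.finite_range _)

theorem exists_perm_of_mem_specht {r c : α → ℕ} {v : (α → ℕ) → ℂ}
    (hv : v ∈ (specht r c).toSubmodule) : ∀ f, v f ≠ 0 → ∃ g : Equiv.Perm α, f = r ∘ g := by
  induction hv using Submodule.span_induction with
  | mem x hx =>
    obtain ⟨g, rfl⟩ := hx
    intro f hf
    obtain ⟨g', hg'⟩ := exists_perm_of_columnDet_ne_zero hf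
    refine ⟨g' * g⁻¹, ?_⟩
    rw [Equiv.Perm.coe_mul, ← Function.comp_assoc, ← hg', Function.comp_assoc]
    ext x
    simp
  | zero => simp
  | add x y _ _ hx hy =>
    intro f hf
    by_cases h : x f = 0
    · exact hy f fun h' => hf (by simp [h, h'])
    · exact hx f h
  | smul a x _ hx => exact fun f hf => hx f fun h => hf (by simp [h])

/-- The polytabloid generating the Specht module. -/
def spechtGen (r c : α → ℕ) : (specht r c).toSubmodule :=
  ⟨columnDet r c, Submodule.subset_span ⟨1, by simp⟩⟩

theorem toRepresentation_spechtGen (r c : α → ℕ) {σ : Equiv.Perm α} (hσ : c ∘ σ = c) :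
    (specht r c).toRepresentation σ (spechtGen r c) =
      ((Equiv.Perm.sign σ : ℤ) : ℂ) • spechtGen r c :=
  Subtype.ext (funext fun f => columnDet_comp r c f hσ)

theorem specht_hom_ext {W : Type*} [AddCommGroup W] [Module ℂ W]
    {ρ : Representation ℂ (Equiv.Perm α) W} {r c : α → ℕ}
    {S T : (specht r c).toSubmodule →ₗ[ℂ] W}
    (hS : ∀ g v, S ((specht r c).toRepresentation g v) = ρ g (S v))
    (hT : ∀ g v, T ((specht r c).toRepresentation g v) = ρ g (T v))
    (h : S (spechtGen r c) = T (spechtGen r c)) : S = T := by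
  refine LinearMap.ext fun ⟨v, hv⟩ => ?_
  induction hv using Submodule.span_induction with
  | mem x hx =>
    obtain ⟨g, rfl⟩ := hx
    have hS' := hS g (spechtGen r c)
    have hT' := hT g (spechtGen r c)
    rw [h, ← hT'] at hS'
    exact hS'
  | zero => exact (map_zero S).trans (map_zero T).symm
  | add x y hx hy hx' hy' =>
    have := congrArg₂ (· + ·) hx' hy'
    simp only [← map_add] at this
    exact this
  | smul a x hx hx' =>
    have := congrArg (a • ·) hx'
    simp only [← map_smul] at this
    exact this

theorem specht_hom_gen_comp {r c r' c' : α → ℕ}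
    {T : (specht r c).toSubmodule →ₗ[ℂ] (specht r' c').toSubmodule}
    (hT : ∀ g v, T ((specht r c).toRepresentation g v) =
      (specht r' c').toRepresentation g (T v))
    (f : α → ℕ) (σ : Equiv.Perm α) (hσ : c ∘ σ = c) :
    (T (spechtGen r c)).1 (f ∘ σ) = (Equiv.Perm.sign σ : ℤ) * (T (spechtGen r c)).1 f := by
  have h := hT σ (spechtGen r c)
  rw [toRepresentation_spechtGen r c hσ, map_smul] at h
  exact (congrFun (congrArg Subtype.val h) f).symm

theorem specht_end_eq_smul {r c : α → ℕ} (h : IsFilling r c)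
    {T : (specht r c).toSubmodule →ₗ[ℂ] (specht r c).toSubmodule}
    (hT : ∀ g v, T ((specht r c).toRepresentation g v) =
      (specht r c).toRepresentation g (T v)) :
    T = (T (spechtGen r c)).1 r • LinearMap.id := by
  refine specht_hom_ext (ρ := (specht r c).toRepresentation) hT (fun g v => by simp) ?_
  exact Subtype.ext (eq_smul_columnDet h (specht_hom_gen_comp hT)
    (exists_perm_of_mem_specht (T (spechtGen r c)).2))

theorem card_lt_le_of_specht_hom {r c r' c' : α → ℕ} (h : IsFilling r c)
    {T : (specht r c).toSubmodule →ₗ[ℂ] (specht r' c').toSubmodule}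
    (hT : ∀ g v, T ((specht r c).toRepresentation g v) =
      (specht r' c').toRepresentation g (T v)) (hT0 : T ≠ 0) (k : ℕ) :
    (Finset.univ.filter fun x => r' x < k).card ≤
      (Finset.univ.filter fun x => r x < k).card := by
  have hne : T (spechtGen r c) ≠ 0 := fun h0 => hT0 <|
    specht_hom_ext (ρ := (specht r' c').toRepresentation) hT (fun g v => by simp) (by simp [h0])
  obtain ⟨f, hf⟩ : ∃ f, (T (spechtGen r c)).1 f ≠ 0 := by
    by_contra! hf
    exact hne (Subtype.ext (funext hf))
  obtain ⟨g, rfl⟩ := exists_perm_of_mem_specht (T (spechtGen r c)).2 f hf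
  rw [← card_comp_perm_lt r' g]
  exact h.card_lt_le (eq_of_apply_ne_zero (specht_hom_gen_comp hT) hf) k

/-- The Specht module as an object of `FDRep`. -/
noncomputable def spechtFDRep (r c : α → ℕ) : FDRep ℂ (Equiv.Perm α) :=
  FDRep.of (specht r c).toRepresentation

open CategoryTheory

theorem FDRep.hom_apply_ρ {k G : Type*} [Field k] [Monoid G] {V W : FDRep k G} (φ : V ⟶ W) (g : G)
    (v : V) : φ.hom.hom.hom (V.ρ g v) = W.ρ g (φ.hom.hom.hom v) :=
  ConcreteCategory.congr_hom (φ.comm g) v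

theorem spechtGen_ne_zero {r c : α → ℕ} (h : IsFilling r c) : spechtGen r c ≠ 0 := by
  intro h0
  have h1 := congrFun (congrArg Subtype.val h0) r
  simp [spechtGen, columnDet_self h] at h1

theorem finrank_spechtFDRep_pos {r c : α → ℕ} (h : IsFilling r c) :
    0 < Module.finrank ℂ (spechtFDRep r c) :=
  Module.finrank_pos_iff_exists_ne_zero.2 ⟨spechtGen r c, spechtGen_ne_zero h⟩

theorem simple_spechtFDRep {r c : α → ℕ} (h : IsFilling r c) : Simple (spechtFDRep r c) := by
  rw [FDRep.simple_iff_end_is_rank_one]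
  refine finrank_eq_one (𝟙 _) (fun h0 => ?_) fun φ => ?_
  · exact spechtGen_ne_zero h (LinearMap.congr_fun
      (congrArg (fun φ : spechtFDRep r c ⟶ spechtFDRep r c => φ.hom.hom.hom) h0) (spechtGen r c))
  · have := specht_end_eq_smul h (T := φ.hom.hom.hom) (FDRep.hom_apply_ρ φ)
    refine ⟨(φ.hom.hom.hom (spechtGen r c)).1 r, ?_⟩
    ext1
    ext1
    ext1
    exact LinearMap.congr_fun this.symm _

theorem card_lt_le_of_iso {r c r' c' : α → ℕ} (h : IsFilling r c)
    (i : spechtFDRep r c ≅ spechtFDRep r' c') (k : ℕ) :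
    (Finset.univ.filter fun x => r' x < k).card ≤
      (Finset.univ.filter fun x => r x < k).card := by
  refine card_lt_le_of_specht_hom h (T := i.hom.hom.hom.hom) (FDRep.hom_apply_ρ i.hom) ?_ k
  intro h0
  exact spechtGen_ne_zero h ((FDRep.isoToLinearEquiv i).map_eq_zero_iff.1
    (LinearMap.congr_fun h0 (spechtGen r c)))

theorem spechtFDRep_character_swap {r c : α → ℕ} (h : IsFilling r c) {τ : Equiv.Perm α}
    (hτ : τ.IsSwap) :
    ((Finset.univ : Finset α).offDiag.card : ℂ) * (spechtFDRep r c).character τ =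
      (∑ p ∈ (Finset.univ : Finset α).offDiag,
        ((if r p.1 = r p.2 then 1 else 0) - (if c p.1 = c p.2 then 1 else 0))) *
        Module.finrank ℂ (spechtFDRep r c) := by
  set ρ := (specht r c).toRepresentation with hρ
  set T := ∑ p ∈ (Finset.univ : Finset α).offDiag, ρ (Equiv.swap p.1 p.2) with hTdef
  have hT : ∀ g v, T (ρ g v) = ρ g (T v) := by
    intro g v
    simp only [hTdef, LinearMap.sum_apply, map_sum]
    refine Finset.sum_equiv ((g⁻¹).prodCongr g⁻¹) (by simp) fun p _ => ?_
    rw [← Module.End.mul_apply, ← Module.End.mul_apply, ← map_mul, ← map_mul]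
    congr 2
    rw [Equiv.mul_swap_eq_swap_mul]
    simp
  have hscalar := specht_end_eq_smul h hT
  have htrace := congrArg (LinearMap.trace ℂ _) hscalar
  have hconj : ∀ p ∈ (Finset.univ : Finset α).offDiag,
      LinearMap.trace ℂ _ (ρ (Equiv.swap p.1 p.2)) = (spechtFDRep r c).character τ := by
    intro p hp
    obtain ⟨x, y, hxy, rfl⟩ := hτ
    obtain ⟨g, hg⟩ := isConj_iff.1
      (Equiv.Perm.isConj_swap hxy (Finset.mem_offDiag.1 hp).2.2)
    rw [← hg]
    exact FDRep.char_conj (spechtFDRep r c) _ _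
  rw [map_smul, LinearMap.trace_id, hTdef, map_sum, Finset.sum_congr rfl hconj,
    Finset.sum_const, nsmul_eq_mul, smul_eq_mul] at htrace
  rw [htrace]
  congr 1
  have hval : ∀ p ∈ (Finset.univ : Finset α).offDiag,
      (ρ (Equiv.swap p.1 p.2) (spechtGen r c)).1 r =
        (if r p.1 = r p.2 then 1 else 0) - (if c p.1 = c p.2 then 1 else 0) := fun p hp =>
    columnDet_comp_swap h (Finset.mem_offDiag.1 hp).2.2
  rw [← Finset.sum_congr rfl hval, LinearMap.sum_apply, AddSubmonoidClass.coe_finsetSum,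
    Finset.sum_apply]

end

section

open CategoryTheory

theorem linearIndependent_character {G ι : Type} [Group G] [Fintype G] {F : ι → FDRep ℂ G}
    (hs : ∀ i, Simple (F i)) (hF : ∀ i j, Nonempty (F i ≅ F j) → i = j) :
    LinearIndependent ℂ fun i => (F i).character := by
  classical
  have : Invertible (Nat.card G : ℂ) := invertibleOfNonzero (by simp)
  rw [linearIndependent_iff']
  intro s a ha j hj
  have h1 : ∑ i ∈ s, a i * ((Nat.card G : ℂ)⁻¹ *
      ∑ g : G, (F i).character g * (F j).character g⁻¹) = 0 := by
    calc
      _ = (Nat.card G : ℂ)⁻¹ *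
          ∑ g : G, (∑ i ∈ s, a i • (F i).character) g * (F j).character g⁻¹ := by
        simp only [Finset.mul_sum, Finset.sum_apply, Pi.smul_apply, smul_eq_mul, Finset.sum_mul]
        rw [Finset.sum_comm]
        refine Finset.sum_congr rfl fun g _ => Finset.sum_congr rfl fun i _ => by ring
      _ = 0 := by rw [ha]; simp
  have h2 : ∀ i ∈ s, a i * ((Nat.card G : ℂ)⁻¹ *
      ∑ g : G, (F i).character g * (F j).character g⁻¹) = if i = j then a i else 0 := by
    intro i _
    have := hs i
    have := hs j
    rw [FDRep.char_orthonormal]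
    by_cases hij : i = j
    · subst hij
      simp [show Nonempty (F i ≅ F i) from ⟨Iso.refl _⟩]
    · rw [if_neg fun h => hij (hF i j h), if_neg hij, mul_zero]
  rw [Finset.sum_congr rfl h2, Finset.sum_ite_eq' s j, if_pos hj] at h1
  exact h1

theorem card_le_of_simple_of_isConj {G ι P : Type} [Group G] [Fintype G] [Fintype ι] [Fintype P]
    {F : ι → FDRep ℂ G} (hs : ∀ i, Simple (F i)) (hF : ∀ i j, Nonempty (F i ≅ F j) → i = j)
    (p : G → P) (hp : ∀ g h, p g = p h → IsConj g h) : Fintype.card ι ≤ Fintype.card P := by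
  have hfactor : ∀ i, ∃ ψ : P → ℂ, LinearMap.funLeft ℂ ℂ p ψ = (F i).character := by
    intro i
    refine ⟨Function.extend p (F i).character 0, funext fun g => ?_⟩
    have hfac : Function.FactorsThrough (F i).character p := by
      intro g h hgh
      obtain ⟨x, rfl⟩ := isConj_iff.1 (hp g h hgh)
      exact (FDRep.char_conj _ _ _).symm
    exact hfac.extend_apply 0 g
  choose ψ hψ using hfactor
  have hli : LinearIndependent ℂ ψ := by
    refine LinearIndependent.of_comp (LinearMap.funLeft ℂ ℂ p) ?_
    convert! linearIndependent_character hs hF using 1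
    exact funext hψ
  simpa using hli.fintype_card_le_finrank

theorem isCompleteIrrepFamily_of_simple {n : ℕ}
    {ρ : Nat.Partition n → FDRep ℂ (Equiv.Perm (Fin n))} (hs : ∀ ν, Simple (ρ ν))
    (hρ : ∀ ν η, Nonempty (ρ ν ≅ ρ η) → ν = η) : IsCompleteIrrepFamily n ρ := by
  refine ⟨hs, hρ, fun W hW => ?_⟩
  by_contra! hWρ
  have hcard := card_le_of_simple_of_isConj 
    (F := fun o : Option (Nat.Partition n) => o.elim W ρ)
    (by rintro (_ | ν); exacts [hW, hs ν]) ?_ (fun g : Equiv.Perm (Fin n) => g.partition)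
    fun g h => Equiv.Perm.partition_eq_of_isConj.2
  · rw [Fintype.card_option, Fintype.card_fin] at hcard
    omega
  · rintro (_ | ν) (_ | η) ⟨i⟩
    · rfl
    · exact ((hWρ η).false i).elim
    · exact ((hWρ ν).false i.symm).elim
    · rw [hρ ν η ⟨i⟩]

end

theorem sum_offDiag_ite_eq {α : Type*} [Fintype α] [DecidableEq α] {h : α → ℕ} {n : ℕ}
    (hn : ∀ x, h x < n) :
    ∑ p ∈ (Finset.univ : Finset α).offDiag, (if h p.1 = h p.2 then 1 else 0) =
      2 * ∑ i ∈ Finset.range n, (Finset.univ.filter fun x => h x = i).card.choose 2 := by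
  rw [Finset.sum_boole, Finset.card_eq_sum_card_fiberwise (f := fun p => h p.1)
    (t := Finset.range n) (fun p _ => by simpa using hn p.1), Finset.mul_sum]
  refine Finset.sum_congr rfl fun i _ => ?_
  have : (Finset.univ.offDiag.filter fun p : α × α => h p.1 = h p.2).filter (fun p => h p.1 = i) =
      (Finset.univ.filter fun x => h x = i).offDiag := by
    ext p
    simp only [Finset.mem_filter, Finset.mem_offDiag, Finset.mem_univ, true_and]
    grind
  rw [this, Finset.offDiag_card, Nat.choose_two_right,
    Nat.mul_div_cancel' (Nat.even_mul_pred_self _).two_dvd, Nat.mul_sub, mul_one]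

theorem exists_isFilling_of_sortedGE {n : ℕ} {L : List ℕ} (hL : L.SortedGE) (hsum : L.sum = n) :
    ∃ r c : Fin n → ℕ, IsFilling r c ∧
      (∀ i, (Finset.univ.filter fun x => r x = i).card = L.getD i 0) ∧
      ∀ j, (Finset.univ.filter fun x => c x = j).card = L.countP (j < ·) := by
  let e : Fin n ≃ (Σ i : Fin L.length, Fin L[i]) := Fintype.equivOfCardEq (by simp [← hsum])
  refine ⟨fun x => (e x).1, fun x => (e x).2, ⟨fun x y hr hc => ?_, fun x i hi => ?_⟩,
    fun i => ?_, fun j => ?_⟩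
  · apply e.injective
    revert hr hc
    rcases e x with ⟨i, j⟩
    rcases e y with ⟨i', j'⟩
    intro hr hc
    obtain rfl := Fin.ext hr
    obtain rfl := Fin.ext hc
    rfl
  · have hle : L[(e x).1] ≤ L[i]'(hi.trans (e x).1.2) := hL.getElem_ge_getElem_of_le hi.le
    refine ⟨e.symm ⟨⟨i, hi.trans (e x).1.2⟩, ⟨(e x).2, (e x).2.2.trans_le hle⟩⟩, ?_, ?_⟩ <;>
      rw [e.apply_symm_apply]
  · rw [Finset.card_filter, e.sum_comp fun z => if (z.1 : ℕ) = i then 1 else 0,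
      Fintype.sum_sigma]
    have hrow : ∀ k : Fin L.length, (∑ _l : Fin L[k], if (k : ℕ) = i then 1 else 0) =
        if (k : ℕ) = i then L[k] else 0 := by
      intro k
      split_ifs <;> simp
    rw [Finset.sum_congr rfl fun k _ => hrow k]
    by_cases hi : i < L.length
    · rw [Finset.sum_eq_single ⟨i, hi⟩ (fun b _ hb => if_neg fun h => hb (Fin.ext h)) (by simp),
        if_pos rfl, List.getD_eq_getElem _ _ hi]
      rfl
    · rw [List.getD_eq_default _ _ (by omega)]
      exact Finset.sum_eq_zero fun b _ => if_neg (by omega)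
  · rw [Finset.card_filter, e.sum_comp fun z => if (z.2 : ℕ) = j then 1 else 0,
      Fintype.sum_sigma]
    have hcol : ∀ i : Fin L.length, (∑ k : Fin L[i], if (k : ℕ) = j then 1 else 0) =
        if j < L[i] then 1 else 0 := by
      intro i
      rw [Fin.sum_univ_eq_sum_range fun k => if k = j then 1 else 0]
      simp
    rw [Finset.sum_congr rfl fun i _ => hcol i]
    refine (Fin.sum_univ_fun_getElem L fun a => if j < a then 1 else 0).trans ?_
    generalize L = l
    induction l with
    | nil => rfl
    | cons a l ih => simp [List.countP_cons, ih, add_comm]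

theorem exists_isFilling {n : ℕ} (ν : Nat.Partition n) :
    ∃ r c : Fin n → ℕ, IsFilling r c ∧
      (∀ i, (Finset.univ.filter fun x => r x = i).card =
        (ν.parts.sort (· ≥ ·)).getD i 0) ∧
      ∀ j, (Finset.univ.filter fun x => c x = j).card = conjugatePart ν (j + 1) := by
  have hparts : (ν.parts.sort (· ≥ ·) : Multiset ℕ) = ν.parts := Multiset.sort_eq _ _
  have hsum : (ν.parts.sort (· ≥ ·)).sum = n := by
    rw [← Multiset.sum_coe, hparts, ν.parts_sum]
  obtain ⟨r, c, h, hr, hc⟩ := exists_isFilling_of_sortedGE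
    (Multiset.pairwise_sort ν.parts (· ≥ ·)).sortedGE hsum
  refine ⟨r, c, h, hr, fun j => ?_⟩
  rw [hc, conjugatePart, ← Multiset.countP_eq_card_filter, ← Multiset.coe_countP, hparts]
  rfl

theorem Nat.Partition.ext_getD_sort {n : ℕ} {ν η : Nat.Partition n}
    (h : ∀ i, (ν.parts.sort (· ≥ ·)).getD i 0 = (η.parts.sort (· ≥ ·)).getD i 0) : ν = η := by
  have key : ∀ (μ : Nat.Partition n) i, (μ.parts.sort (· ≥ ·))[i]? =
      if (μ.parts.sort (· ≥ ·)).getD i 0 = 0 then none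
      else some ((μ.parts.sort (· ≥ ·)).getD i 0) := by
    intro μ i
    by_cases hi : i < (μ.parts.sort (· ≥ ·)).length
    · have := μ.parts_pos ((Multiset.mem_sort (· ≥ ·)).1 (List.getElem_mem hi))
      rw [List.getD_eq_getElem _ _ hi, if_neg this.ne', List.getElem?_eq_getElem hi]
    · rw [List.getD_eq_default _ _ (by omega), if_pos rfl, List.getElem?_eq_none (by omega)]
  have hsort : ν.parts.sort (· ≥ ·) = η.parts.sort (· ≥ ·) :=
    List.ext_getElem? fun i => by rw [key, key, h]
  refine Nat.Partition.ext ?_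
  rw [← Multiset.sort_eq ν.parts (· ≥ ·), hsort, Multiset.sort_eq]

theorem Nat.Partition.card_parts_le {n : ℕ} (ν : Nat.Partition n) : ν.parts.card ≤ n := by
  have := Multiset.card_nsmul_le_sum (s := ν.parts) (a := 1) fun x hx => ν.parts_pos hx
  simpa [ν.parts_sum] using this

theorem Nat.Partition.sum_getD_sort_choose_two {n : ℕ} (ν : Nat.Partition n) :
    ∑ i ∈ Finset.range n, ((ν.parts.sort (· ≥ ·)).getD i 0).choose 2 =
      (ν.parts.map fun a => a.choose 2).sum := by
  set L := ν.parts.sort (· ≥ ·) with hL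
  have hparts : (L : Multiset ℕ) = ν.parts := Multiset.sort_eq _ _
  have hlen : L.length ≤ n := by
    rw [hL, Multiset.length_sort]
    exact ν.card_parts_le
  rw [← hparts, Multiset.map_coe, Multiset.sum_coe,
    ← Finset.sum_subset (Finset.range_subset_range.2 hlen), Finset.sum_range,
    ← Fin.sum_univ_fun_getElem]
  · exact Finset.sum_congr rfl fun i _ => by rw [List.getD_eq_getElem _ _ i.2]
  · intro i _ hi
    rw [List.getD_eq_default _ _ (by simpa using hi)]
    rfl

/-- Frobenius/Ingram formula: for a partition `ν ⊢ n` with conjugate `ν′` and any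
transposition `τ`, the normalized character satisfies
`χ_ν(τ)/dim ρ_ν = (1/C(n,2)) ∑_j (C(ν_j,2) − C(ν′_j,2))`. -/
theorem stmt_7 (n : ℕ) (hn : 2 ≤ n) (τ : Equiv.Perm (Fin n)) (hτ : τ.IsSwap) :
    ∃ ρ : Nat.Partition n → FDRep ℂ (Equiv.Perm (Fin n)),
      IsCompleteIrrepFamily n ρ ∧
        ∀ ν : Nat.Partition n,
          (ρ ν).character τ / (Module.finrank ℂ (ρ ν) : ℂ) =
            (1 / (n.choose 2 : ℂ)) *
              (((ν.parts.map fun a => a.choose 2).sum : ℂ) -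
                ((∑ j ∈ Finset.Icc 1 n, (conjugatePart ν j).choose 2 : ℕ) : ℂ)) := by
  choose r c hrc hr hc using exists_isFilling (n := n)
  have hsimple : ∀ ν, CategoryTheory.Simple (spechtFDRep (r ν) (c ν)) :=
    fun ν => simple_spechtFDRep (hrc ν)
  refine ⟨fun ν => spechtFDRep (r ν) (c ν), isCompleteIrrepFamily_of_simple hsimple ?_,
    fun ν => ?_⟩
  · rintro ν η ⟨i⟩
    have hlt : ∀ k, (Finset.univ.filter fun x => r ν x < k).card =
        (Finset.univ.filter fun x => r η x < k).card := fun k =>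
      le_antisymm (card_lt_le_of_iso (hrc η) i.symm k) (card_lt_le_of_iso (hrc ν) i k)
    have hsucc : ∀ μ k, (Finset.univ.filter fun x => r μ x < k + 1).card =
        (Finset.univ.filter fun x => r μ x < k).card +
          (Finset.univ.filter fun x => r μ x = k).card := by
      intro μ k
      rw [← Finset.card_union_of_disjoint
        (Finset.disjoint_filter.2 fun x _ h1 h2 => h1.ne h2), ← Finset.filter_or]
      simp only [Nat.lt_succ_iff_lt_or_eq]
    refine Nat.Partition.ext_getD_sort fun k => ?_
    rw [← hr ν, ← hr η]
    have h1 := hsucc ν k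
    have h2 := hsucc η k
    rw [hlt, hlt] at h1
    omega
  · have hrn : ∀ x, r ν x < n := by
      intro x
      by_contra! hx
      have h1 := hr ν (r ν x)
      rw [List.getD_eq_default _ _ (by
        rw [Multiset.length_sort]; exact ν.card_parts_le.trans hx), Finset.card_eq_zero] at h1
      exact Finset.notMem_empty x (h1 ▸ by simp)
    have hcn : ∀ x, c ν x < n := by
      intro x
      have h1 : 0 < conjugatePart ν (c ν x + 1) := by
        rw [← hc]
        exact Finset.card_pos.2 ⟨x, by simp⟩
      obtain ⟨a, ha⟩ := Multiset.card_pos_iff_exists_mem.1 h1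
      rw [Multiset.mem_filter] at ha
      exact ha.2.trans (ν.le_of_mem_parts ha.1)
    have hrow := sum_offDiag_ite_eq hrn
    have hcol := sum_offDiag_ite_eq hcn
    simp only [hr, hc, ν.sum_getD_sort_choose_two] at hrow hcol
    rw [Finset.range_eq_Ico, Finset.sum_Ico_add' (fun j => (conjugatePart ν j).choose 2),
      zero_add, Finset.Ico_add_one_right_eq_Icc] at hcol
    have hrowC := congrArg (Nat.cast : ℕ → ℂ) hrow
    have hcolC := congrArg (Nat.cast : ℕ → ℂ) hcol
    have hchar := spechtFDRep_character_swap (hrc ν) hτ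
    have hcard : ((Finset.univ : Finset (Fin n)).offDiag.card : ℂ) = 2 * (n.choose 2 : ℂ) := by
      rw [Nat.cast_choose_two, Finset.offDiag_card, Finset.card_univ, Fintype.card_fin,
        Nat.cast_sub (Nat.le_mul_self n)]
      push_cast
      ring
    have hd : (Module.finrank ℂ (spechtFDRep (r ν) (c ν)) : ℂ) ≠ 0 :=
      Nat.cast_ne_zero.2 (finrank_spechtFDRep_pos (hrc ν)).ne'
    have hchoose : (n.choose 2 : ℂ) ≠ 0 := Nat.cast_ne_zero.2 (Nat.choose_pos hn).ne'
    push_cast at hrowC hcolC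
    simp only [Multiset.map_map, Function.comp_def] at hrowC
    rw [Finset.sum_sub_distrib, hrowC, hcolC, hcard] at hchar
    push_cast
    rw [div_eq_iff hd, one_div, mul_assoc, eq_inv_mul_iff_mul_eq₀ hchoose]
    linear_combination hchar / 2
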